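/- arXiv:1304.5159 — 3 statements merged into one kernel-verified Lean document; each statement's English description precedes it below -/
import Mathlib

section
/- There exists a constant c > 0 depending only on the discount factor φ such that the following holds. For any such model, any ε ≥ 0, any belief b, state s and action v with b(s) ≥ 1 − ε, if for every state s̃, action ṽ ∈ V and action u ∈ U there exist a state s' and an observation o with T(s̃,ṽ,u,s') ≥ 1 − ε/2 and Z(s',ṽ,o) ≥ 1 − ε/2, then for every n ≥ 0: |Q̂ⁿ(s,v) − Q̂ⁿ(b,v)| ≤ c · ε · (R_max − R_min)/(1 − φ). -/
open Finset

noncomputable section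

variable {S U V O : Type*}

/-- `b : S → ℝ` is a belief (probability distribution over states). -/
def IsBelief [Fintype S] (b : S → ℝ) : Prop :=
  (∀ s, 0 ≤ b s) ∧ ∑ s, b s = 1

/-- MDP Q-values of the other agent (treating our agent's actions as uniform):
`Q̂⁰(s,v) = 0`,
`Q̂ⁿ⁺¹(s,v) = |U|⁻¹ Σ_u [ R(s,v,u) + φ Σ_{s'} T(s,v,u,s') max_{v'} Q̂ⁿ(s',v') ]`. -/
def mdpQ [Fintype S] [Fintype U] [Fintype V] [Nonempty V]
    (T : S → V → U → S → ℝ) (R : S → V → U → ℝ) (φ : ℝ) : ℕ → S → V → ℝ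
  | 0, _, _ => 0
  | n + 1, s, v =>
      (Fintype.card U : ℝ)⁻¹ *
        ∑ u, (R s v u + φ * ∑ s', T s v u s' * ⨆ v' : V, mdpQ T R φ n s' v')

/-- Belief-state observation model `Pr(o|b,v,u) = Σ_{s'} Z(s',v,o) Σ_s T(s,v,u,s') b(s)`. -/
def obsPr0 [Fintype S] (T : S → V → U → S → ℝ) (Z : S → V → O → ℝ)
    (b : S → ℝ) (v : V) (u : U) (o : O) : ℝ :=
  ∑ s', Z s' v o * ∑ s, T s v u s' * b s

/-- Bayesian belief update `b_u^{v,o}(s') = Z(s',v,o) Σ_s T(s,v,u,s') b(s) / Pr(o|b,v,u)`. -/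
def beliefUpd0 [Fintype S] (T : S → V → U → S → ℝ) (Z : S → V → O → ℝ)
    (b : S → ℝ) (v : V) (u : U) (o : O) (s' : S) : ℝ :=
  Z s' v o * (∑ s, T s v u s' * b s) / obsPr0 T Z b v u o

/-- POMDP Q-values over beliefs of the other agent:
`Q̂⁰(b,v) = 0`,
`Q̂ⁿ⁺¹(b,v) = |U|⁻¹ Σ_u [ Σ_s b(s) R(s,v,u) + φ Σ_o Pr(o|b,v,u) max_{v'} Q̂ⁿ(b_u^{v,o},v') ]`
(summands with `Pr(o|b,v,u) = 0` vanish since they are multiplied by `0`). -/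
def pomdpQ [Fintype S] [Fintype U] [Fintype V] [Fintype O] [Nonempty V]
    (T : S → V → U → S → ℝ) (Z : S → V → O → ℝ) (R : S → V → U → ℝ)
    (φ : ℝ) : ℕ → (S → ℝ) → V → ℝ
  | 0, _, _ => 0
  | n + 1, b, v =>
      (Fintype.card U : ℝ)⁻¹ *
        ∑ u, ((∑ s, b s * R s v u) +
          φ * ∑ o, obsPr0 T Z b v u o *
            ⨆ v' : V, pomdpQ T Z R φ n (beliefUpd0 T Z b v u o) v')

lemma card_inv_mul_sum_le_of_le {U : Type*} [Fintype U] [Nonempty U] {x : U → ℝ} {a : ℝ}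
    (h : ∀ u, x u ≤ a) : (Fintype.card U : ℝ)⁻¹ * ∑ u, x u ≤ a := by
  have hc : (0 : ℝ) < Fintype.card U := by exact_mod_cast Fintype.card_pos
  rw [inv_mul_le_iff₀ hc]
  simpa using Finset.sum_le_sum fun u (_ : u ∈ Finset.univ) => h u

lemma le_card_inv_mul_sum_of_le {U : Type*} [Fintype U] [Nonempty U] {x : U → ℝ} {a : ℝ}
    (h : ∀ u, a ≤ x u) : a ≤ (Fintype.card U : ℝ)⁻¹ * ∑ u, x u := by
  have hc : (0 : ℝ) < Fintype.card U := by exact_mod_cast Fintype.card_pos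
  rw [le_inv_mul_iff₀ hc]
  simpa using Finset.sum_le_sum fun u (_ : u ∈ Finset.univ) => h u

lemma IsBelief.sum_mul_le {S : Type*} [Fintype S] {b f : S → ℝ} {a : ℝ} (hb : IsBelief b)
    (h : ∀ s, f s ≤ a) : ∑ s, b s * f s ≤ a :=
  calc ∑ s, b s * f s ≤ ∑ s, b s * a :=
        Finset.sum_le_sum fun s _ => mul_le_mul_of_nonneg_left (h s) (hb.1 s)
    _ = a := by rw [← Finset.sum_mul, hb.2, one_mul]

lemma IsBelief.le_sum_mul {S : Type*} [Fintype S] {b f : S → ℝ} {a : ℝ} (hb : IsBelief b)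
    (h : ∀ s, a ≤ f s) : a ≤ ∑ s, b s * f s :=
  calc a = ∑ s, b s * a := by rw [← Finset.sum_mul, hb.2, one_mul]
    _ ≤ ∑ s, b s * f s :=
        Finset.sum_le_sum fun s _ => mul_le_mul_of_nonneg_left (h s) (hb.1 s)

lemma IsBelief.le_one {S : Type*} [Fintype S] {b : S → ℝ} (hb : IsBelief b) (s : S) :
    b s ≤ 1 :=
  hb.2 ▸ Finset.single_le_sum (fun i _ => hb.1 i) (Finset.mem_univ s)

/-- A function bounded above by `D` that vanishes at `s` has mean at most
`(1 - b s) * D`. -/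
lemma IsBelief.sum_mul_le_of_eq_zero {S : Type*} [Fintype S] {b f : S → ℝ} {D : ℝ} {s : S}
    (hb : IsBelief b) (hs : f s = 0) (hf : ∀ t, f t ≤ D) :
    ∑ t, b t * f t ≤ (1 - b s) * D := by
  classical
  have h1 := hb.2
  rw [← Finset.add_sum_erase _ _ (Finset.mem_univ s)] at h1 ⊢
  rw [hs, mul_zero, zero_add, show 1 - b s = ∑ t ∈ Finset.univ.erase s, b t by linarith,
    Finset.sum_mul]
  exact Finset.sum_le_sum fun t _ => mul_le_mul_of_nonneg_left (hf t) (hb.1 t)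

lemma IsBelief.abs_sub_sum_mul_le {S : Type*} [Fintype S] {b f : S → ℝ} {D : ℝ}
    (hb : IsBelief b) (s : S) (hf : ∀ t t', f t - f t' ≤ D) :
    |f s - ∑ t, b t * f t| ≤ (1 - b s) * D := by
  have h1 := hb.sum_mul_le_of_eq_zero (f := fun t => f t - f s) (sub_self _) (fun t => hf t s)
  have h2 := hb.sum_mul_le_of_eq_zero (f := fun t => f s - f t) (sub_self _) (fun t => hf s t)
  simp only [mul_sub, Finset.sum_sub_distrib, ← Finset.sum_mul, hb.2, one_mul] at h1 h2
  exact abs_le.2 ⟨by linarith, h2⟩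

section Update

variable [Fintype S] {T : S → V → U → S → ℝ} {Z : S → V → O → ℝ} {b : S → ℝ}

lemma obsPr0_nonneg (hT : ∀ s v u s', 0 ≤ T s v u s') (hZ : ∀ s' v o, 0 ≤ Z s' v o)
    (hb : ∀ s, 0 ≤ b s) (v : V) (u : U) (o : O) : 0 ≤ obsPr0 T Z b v u o :=
  Finset.sum_nonneg fun _ _ => mul_nonneg (hZ _ _ _)
    (Finset.sum_nonneg fun s _ => mul_nonneg (hT _ _ _ _) (hb s))

lemma obsPr0_mul_beliefUpd0 (hT : ∀ s v u s', 0 ≤ T s v u s') (hZ : ∀ s' v o, 0 ≤ Z s' v o)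
    (hb : ∀ s, 0 ≤ b s) (v : V) (u : U) (o : O) (s' : S) :
    obsPr0 T Z b v u o * beliefUpd0 T Z b v u o s' = Z s' v o * ∑ s, T s v u s' * b s := by
  by_cases h : obsPr0 T Z b v u o = 0
  · rw [h, zero_mul]
    refine ((Finset.sum_eq_zero_iff_of_nonneg fun t _ => mul_nonneg (hZ t v o)
      (Finset.sum_nonneg fun s _ => mul_nonneg (hT s v u t) (hb s))).1 h s'
      (Finset.mem_univ _)).symm
  · exact mul_div_cancel₀ _ h

lemma isBelief_beliefUpd0 (hT : ∀ s v u s', 0 ≤ T s v u s') (hZ : ∀ s' v o, 0 ≤ Z s' v o)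
    (hb : ∀ s, 0 ≤ b s) {v : V} {u : U} {o : O} (h : obsPr0 T Z b v u o ≠ 0) :
    IsBelief (beliefUpd0 T Z b v u o) := by
  refine ⟨fun s' => div_nonneg (mul_nonneg (hZ _ _ _)
    (Finset.sum_nonneg fun s _ => mul_nonneg (hT _ _ _ _) (hb s)))
    (obsPr0_nonneg hT hZ hb v u o), ?_⟩
  simp only [beliefUpd0, ← Finset.sum_div]
  exact div_self h

/-- The posterior, averaged over observations, is the predicted belief. -/
lemma sum_obsPr0_mul_beliefUpd0 [Fintype O] (hT : ∀ s v u s', 0 ≤ T s v u s')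
    (hZ : ∀ s' v o, 0 ≤ Z s' v o) (hZ1 : ∀ s' v, ∑ o, Z s' v o = 1)
    (hb : ∀ s, 0 ≤ b s) (v : V) (u : U) (s' : S) :
    ∑ o, obsPr0 T Z b v u o * beliefUpd0 T Z b v u o s' = ∑ s, T s v u s' * b s := by
  simp only [obsPr0_mul_beliefUpd0 hT hZ hb, ← Finset.sum_mul, hZ1, one_mul]

lemma sum_obsPr0 [Fintype O] (hT1 : ∀ s v u, ∑ s', T s v u s' = 1)
    (hZ1 : ∀ s' v, ∑ o, Z s' v o = 1) (hb : ∑ s, b s = 1) (v : V) (u : U) :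
    ∑ o, obsPr0 T Z b v u o = 1 := by
  simp only [obsPr0]
  rw [Finset.sum_comm]
  simp only [← Finset.sum_mul, hZ1, one_mul]
  rw [Finset.sum_comm]
  simp only [← Finset.sum_mul, hT1, one_mul, hb]

/-- The gap between the belief average of the MDP values and the POMDP value is the expected
discounted gap of the optimal values at the next belief. -/
lemma sum_mul_mdpQ_sub_pomdpQ_succ [Fintype U] [Fintype V] [Fintype O] [Nonempty V]
    (R : S → V → U → ℝ) (φ : ℝ) (hT : ∀ s v u s', 0 ≤ T s v u s')
    (hZ : ∀ s' v o, 0 ≤ Z s' v o) (hZ1 : ∀ s' v, ∑ o, Z s' v o = 1)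
    (hb : ∀ s, 0 ≤ b s) (n : ℕ) (v : V) :
    ∑ s, b s * mdpQ T R φ (n + 1) s v - pomdpQ T Z R φ (n + 1) b v =
      (Fintype.card U : ℝ)⁻¹ * ∑ u, φ * ∑ o, obsPr0 T Z b v u o *
        (∑ s', beliefUpd0 T Z b v u o s' * (⨆ v', mdpQ T R φ n s' v') -
          ⨆ v', pomdpQ T Z R φ n (beliefUpd0 T Z b v u o) v') := by
  have key (u : U) : ∑ o, obsPr0 T Z b v u o *
      ∑ s', beliefUpd0 T Z b v u o s' * (⨆ v', mdpQ T R φ n s' v') =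
      ∑ s, b s * ∑ s', T s v u s' * ⨆ v', mdpQ T R φ n s' v' := by
    simp only [Finset.mul_sum, ← mul_assoc]
    rw [Finset.sum_comm]
    conv_rhs => rw [Finset.sum_comm]
    refine Finset.sum_congr rfl fun s' _ => ?_
    rw [← Finset.sum_mul, ← Finset.sum_mul, sum_obsPr0_mul_beliefUpd0 hT hZ hZ1 hb]
    simp only [mul_comm]
  have hsum : ∑ s, b s * mdpQ T R φ (n + 1) s v = (Fintype.card U : ℝ)⁻¹ *
      ∑ u, (∑ s, b s * R s v u +
        φ * ∑ s, b s * ∑ s', T s v u s' * ⨆ v', mdpQ T R φ n s' v') := by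
    simp only [mdpQ, Finset.mul_sum, mul_add, Finset.sum_add_distrib]
    congr 1
    · rw [Finset.sum_comm]
      exact Finset.sum_congr rfl fun u _ => Finset.sum_congr rfl fun s _ => by ring
    · rw [Finset.sum_comm]
      exact Finset.sum_congr rfl fun u _ => Finset.sum_congr rfl fun s _ =>
        Finset.sum_congr rfl fun s' _ => by ring
  rw [hsum, pomdpQ, ← mul_sub, ← Finset.sum_sub_distrib]
  congr 1
  refine Finset.sum_congr rfl fun u _ => ?_
  simp only [mul_sub, Finset.sum_sub_distrib, key]
  ring

/-- The POMDP value is at most the belief average of the MDP values. -/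
lemma pomdpQ_le_sum_mul_mdpQ [Fintype U] [Fintype V] [Fintype O] [Nonempty U] [Nonempty V]
    (R : S → V → U → ℝ) {φ : ℝ} (hφ : 0 ≤ φ) (hT : ∀ s v u s', 0 ≤ T s v u s')
    (hZ : ∀ s' v o, 0 ≤ Z s' v o) (hZ1 : ∀ s' v, ∑ o, Z s' v o = 1)
    (hb : IsBelief b) (n : ℕ) (v : V) :
    pomdpQ T Z R φ n b v ≤ ∑ s, b s * mdpQ T R φ n s v := by
  induction n generalizing b v with
  | zero => simp [mdpQ, pomdpQ]
  | succ n ih =>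
    rw [← sub_nonneg, sum_mul_mdpQ_sub_pomdpQ_succ R φ hT hZ hZ1 hb.1]
    refine le_card_inv_mul_sum_of_le fun u => mul_nonneg hφ (Finset.sum_nonneg fun o _ => ?_)
    by_cases h : obsPr0 T Z b v u o = 0
    · simp [h]
    have hb' := isBelief_beliefUpd0 hT hZ hb.1 h
    refine mul_nonneg (obsPr0_nonneg hT hZ hb.1 v u o) (sub_nonneg.2 (ciSup_le fun v' => ?_))
    exact (ih hb' v').trans (Finset.sum_le_sum fun s _ => mul_le_mul_of_nonneg_left
      (le_ciSup (f := fun v' => mdpQ T R φ n s v') (Set.finite_range _).bddAbove v') (hb'.1 s))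

/-- The MDP values vary by at most `(Rmax - Rmin) / (1 - φ)`. -/
lemma mdpQ_sub_mdpQ_le [Fintype U] [Fintype V] [Nonempty S] [Nonempty U] [Nonempty V]
    {R : S → V → U → ℝ} {φ Rmin Rmax : ℝ} (hφ0 : 0 ≤ φ) (hφ1 : φ < 1)
    (hT : ∀ s v u s', 0 ≤ T s v u s') (hT1 : ∀ s v u, ∑ s', T s v u s' = 1)
    (hR : ∀ s v u, Rmin ≤ R s v u ∧ R s v u ≤ Rmax) (n : ℕ) (s s' : S) (v v' : V) :
    mdpQ T R φ n s v - mdpQ T R φ n s' v' ≤ (Rmax - Rmin) / (1 - φ) := by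
  set D := (Rmax - Rmin) / (1 - φ) with hD
  have hφ : 0 < 1 - φ := by linarith
  have hDeq : D * (1 - φ) = Rmax - Rmin := div_mul_cancel₀ _ hφ.ne'
  suffices h : ∃ m, ∀ s v, m ≤ mdpQ T R φ n s v ∧ mdpQ T R φ n s v ≤ m + D by
    obtain ⟨m, hm⟩ := h
    linarith [(hm s v).2, (hm s' v').1]
  clear s s' v v'
  induction n with
  | zero =>
    obtain ⟨h1, h2⟩ := hR (Classical.arbitrary S) (Classical.arbitrary V) (Classical.arbitrary U)
    have : 0 ≤ D := div_nonneg (by linarith) hφ.le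
    exact ⟨0, fun s v => by simpa [mdpQ] using this⟩
  | succ n ih =>
    obtain ⟨m, hm⟩ := ih
    refine ⟨Rmin + φ * m, fun s v => ?_⟩
    have hTb (u : U) : IsBelief (T s v u) := ⟨hT s v u, hT1 s v u⟩
    refine ⟨le_card_inv_mul_sum_of_le fun u => ?_, card_inv_mul_sum_le_of_le fun u => ?_⟩
    · have := (hTb u).le_sum_mul (f := fun s' => ⨆ v', mdpQ T R φ n s' v') (a := m) fun s' =>
        (hm s' (Classical.arbitrary V)).1.trans
          (le_ciSup (f := fun v' => mdpQ T R φ n s' v') (Set.finite_range _).bddAbove _)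
      have := mul_le_mul_of_nonneg_left this hφ0
      linarith [(hR s v u).1]
    · have := (hTb u).sum_mul_le (f := fun s' => ⨆ v', mdpQ T R φ n s' v') (a := m + D) fun s' =>
        ciSup_le fun v' => (hm s' v').2
      have := mul_le_mul_of_nonneg_left this hφ0
      linarith [(hR s v u).2]

/-- If transitions are within `δ` of deterministic and the MDP values vary by at most `D`, the
POMDP value falls short of the belief average of the MDP values by at most a quantity linear in
`1 - b s` and `δ`. -/
lemma sum_mul_mdpQ_sub_pomdpQ_le [Fintype U] [Fintype V] [Fintype O] [Nonempty U] [Nonempty V]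
    {R : S → V → U → ℝ} {φ D δ A B : ℝ} (hφ0 : 0 ≤ φ)
    (hT : ∀ s v u s', 0 ≤ T s v u s') (hT1 : ∀ s v u, ∑ s', T s v u s' = 1)
    (hZ : ∀ s' v o, 0 ≤ Z s' v o) (hZ1 : ∀ s' v, ∑ o, Z s' v o = 1)
    (hD : ∀ n s s' v v', mdpQ T R φ n s v - mdpQ T R φ n s' v' ≤ D)
    (hδ0 : 0 ≤ δ) (hδ : ∀ s v u, ∃ s', 1 - δ ≤ T s v u s')
    (hA0 : 0 ≤ A) (hB0 : 0 ≤ B) (hA : φ * (D + A) = A) (hB : A + φ * B = B)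
    (hb : IsBelief b) (n : ℕ) (s : S) (v : V) :
    ∑ t, b t * mdpQ T R φ n t v - pomdpQ T Z R φ n b v ≤ A * (1 - b s) + B * δ := by
  induction n generalizing b s v with
  | zero =>
    simpa [mdpQ, pomdpQ] using
      add_nonneg (mul_nonneg hA0 (sub_nonneg.2 (hb.le_one s))) (mul_nonneg hB0 hδ0)
  | succ n ih =>
    rw [sum_mul_mdpQ_sub_pomdpQ_succ R φ hT hZ hZ1 hb.1]
    refine card_inv_mul_sum_le_of_le fun u => ?_
    obtain ⟨s', hs'⟩ := hδ s v u
    have hstep (o : O) : obsPr0 T Z b v u o *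
        (∑ t, beliefUpd0 T Z b v u o t * (⨆ v', mdpQ T R φ n t v') -
          ⨆ v', pomdpQ T Z R φ n (beliefUpd0 T Z b v u o) v') ≤
        obsPr0 T Z b v u o * ((D + A) * (1 - beliefUpd0 T Z b v u o s') + B * δ) := by
      by_cases h : obsPr0 T Z b v u o = 0
      · simp [h]
      have hb' := isBelief_beliefUpd0 hT hZ hb.1 h
      refine mul_le_mul_of_nonneg_left ?_ (obsPr0_nonneg hT hZ hb.1 v u o)
      generalize beliefUpd0 T Z b v u o = b' at hb'
      obtain ⟨w, hw⟩ := exists_eq_ciSup_of_finite (f := fun v' => mdpQ T R φ n s' v')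
      have h1 := hb'.sum_mul_le_of_eq_zero (D := D) (s := s')
        (f := fun t => (⨆ v', mdpQ T R φ n t v') - mdpQ T R φ n t w)
        (sub_eq_zero.2 hw.symm)
        (fun t => sub_le_iff_le_add.2 (ciSup_le fun v' => by linarith [hD n t t v' w]))
      simp only [mul_sub, Finset.sum_sub_distrib] at h1
      have h2 := ih hb' s' w
      have h3 := le_ciSup (f := fun v' => pomdpQ T Z R φ n b' v') (Set.finite_range _).bddAbove w
      linarith
    have hpred : b s - δ ≤ ∑ t, T t v u s' * b t := by
      have h1 := Finset.single_le_sum (f := fun t => T t v u s' * b t)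
        (fun t _ => mul_nonneg (hT t v u s') (hb.1 t)) (Finset.mem_univ s)
      have h2 := mul_le_mul_of_nonneg_right hs' (hb.1 s)
      have h3 := mul_le_mul_of_nonneg_left (hb.le_one s) hδ0
      linarith
    have hD0 : 0 ≤ D := (sub_self (mdpQ T R φ 0 s v)) ▸ hD 0 s s v v
    have hsum : ∑ o, obsPr0 T Z b v u o *
        ((D + A) * (1 - beliefUpd0 T Z b v u o s') + B * δ) =
        (D + A) * (1 - ∑ t, T t v u s' * b t) + B * δ := by
      rw [← sum_obsPr0_mul_beliefUpd0 hT hZ hZ1 hb.1 v u s']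
      have h1 := sum_obsPr0 hT1 hZ1 hb.2 v u
      calc _ = (D + A) * (∑ o, obsPr0 T Z b v u o -
              ∑ o, obsPr0 T Z b v u o * beliefUpd0 T Z b v u o s') +
              B * δ * ∑ o, obsPr0 T Z b v u o := by
            rw [← Finset.sum_sub_distrib, Finset.mul_sum, Finset.mul_sum,
              ← Finset.sum_add_distrib]
            exact Finset.sum_congr rfl fun o _ => by ring
        _ = _ := by rw [h1, mul_one]
    calc _ ≤ φ * ((D + A) * (1 - ∑ t, T t v u s' * b t) + B * δ) :=
          mul_le_mul_of_nonneg_left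
            ((Finset.sum_le_sum fun o _ => hstep o).trans_eq hsum) hφ0
      _ = A * (1 - ∑ t, T t v u s' * b t) + φ * B * δ := by
          linear_combination (1 - ∑ t, T t v u s' * b t) * hA
      _ ≤ A * (1 - b s + δ) + φ * B * δ := by
          gcongr
          linarith
      _ = A * (1 - b s) + B * δ := by linear_combination δ * hB

end Update

/-- **Theorem 1 (I-POMDP Lite):** there is a constant `c > 0` depending only on the
discount factor `φ` such that, for any model with fine sensing and actuation
capabilities (observation and transition models `ε`-close to deterministic) and any
belief `b` with `b(s) ≥ 1 − ε`,
`|Q̂ⁿ(s,v) − Q̂ⁿ(b,v)| ≤ c · ε · (R_max − R_min)/(1 − φ)` for all `n`. -/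
theorem mdp_pomdp_q_close (φ : ℝ) (hφ0 : 0 < φ) (hφ1 : φ < 1) :
    ∃ c : ℝ, 0 < c ∧
      ∀ (S U V O : Type) [Fintype S] [Fintype U] [Fintype V] [Fintype O]
        [Nonempty S] [Nonempty U] [Nonempty V] [Nonempty O]
        (T : S → V → U → S → ℝ) (Z : S → V → O → ℝ) (R : S → V → U → ℝ)
        (Rmin Rmax : ℝ),
        (∀ s v u s', 0 ≤ T s v u s') →
        (∀ s v u, ∑ s', T s v u s' = 1) →
        (∀ s' v o, 0 ≤ Z s' v o) →
        (∀ s' v, ∑ o, Z s' v o = 1) →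
        (∀ s v u, Rmin ≤ R s v u ∧ R s v u ≤ Rmax) →
        ∀ ε : ℝ, 0 ≤ ε →
        ∀ b : S → ℝ, IsBelief b →
        ∀ (s : S) (v : V), 1 - ε ≤ b s →
        (∀ (sa : S) (va : V) (u : U), ∃ (s' : S) (o : O),
            1 - ε / 2 ≤ T sa va u s' ∧ 1 - ε / 2 ≤ Z s' va o) →
        ∀ n : ℕ,
          |mdpQ T R φ n s v - pomdpQ T Z R φ n b v| ≤
            c * ε * (Rmax - Rmin) / (1 - φ) := by
  have hφ : 0 < 1 - φ := by linarith
  refine ⟨1 + φ / (1 - φ) + φ / (1 - φ) / (1 - φ) / 2, by positivity, ?_⟩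
  intro S U V O _ _ _ _ _ _ _ _ T Z R Rmin Rmax hT hT1 hZ hZ1 hR ε hε b hb s v hbs hdet n
  have hD := mdpQ_sub_mdpQ_le hφ0.le hφ1 hT hT1 hR
  rw [mul_div_assoc]
  set D := (Rmax - Rmin) / (1 - φ)
  have hD0 : 0 ≤ D := (sub_self (mdpQ T R φ 0 s v)) ▸ hD 0 s s v v
  have hgap := sum_mul_mdpQ_sub_pomdpQ_le (δ := ε / 2) (A := φ / (1 - φ) * D)
    (B := φ / (1 - φ) / (1 - φ) * D) hφ0.le hT hT1 hZ hZ1 hD (by positivity)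
    (fun s v u => let ⟨s', _, h, _⟩ := hdet s v u; ⟨s', h⟩)
    (by positivity) (by positivity) (by field_simp; ring) (by field_simp; ring) hb n s v
  have hle := pomdpQ_le_sum_mul_mdpQ R hφ0.le hT hZ hZ1 hb n v
  have hpt := hb.abs_sub_sum_mul_le s fun t t' => hD n t t' v v
  have hA := mul_le_mul_of_nonneg_left (show 1 - b s ≤ ε by linarith)
    (show 0 ≤ φ / (1 - φ) * D by positivity)
  have hA' := mul_le_mul_of_nonneg_right (show 1 - b s ≤ ε by linarith) hD0
  calc _ ≤ |mdpQ T R φ n s v - ∑ t, b t * mdpQ T R φ n t v| +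
        |∑ t, b t * mdpQ T R φ n t v - pomdpQ T Z R φ n b v| := abs_sub_le _ _ _
    _ ≤ ε * D + (φ / (1 - φ) * D * ε + φ / (1 - φ) / (1 - φ) * D * (ε / 2)) := by
        rw [abs_of_nonneg (sub_nonneg.2 hle)]
        linarith
    _ = _ := by ring
end
end

section
/- If W is a bounded function from beliefs to ℝ satisfying the Bellman fixed-point equation W(b) = max_{u∈U} [ R_Pr(b,u) + φ Σ_{v,o} Pr_Pr(v,o|b,u) · W(B_Pr(b,u,v,o)) ] for all beliefs b (summands with Pr_Pr(v,o|b,u) = 0 taken to be 0), then for every n ≥ 0: sup_b |W(b) − V_{n+1}(b)| ≤ φ · sup_b |W(b) − V_n(b)|, where both suprema are over all beliefs b. -/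
open Finset

noncomputable section

variable {S U V O : Type*}

/-- `P : S → V → ℝ` is a (mixed) strategy of the other agent. -/
def IsStrategy [Fintype V] (P : S → V → ℝ) : Prop :=
  (∀ s v, 0 ≤ P s v) ∧ ∀ s, ∑ v, P s v = 1

/-- Expected immediate payoff `R_P(b,u) = Σ_{s,v} b(s) P(s,v) R(s,u,v)`. -/
def expR [Fintype S] [Fintype V] (R : S → U → V → ℝ) (P : S → V → ℝ)
    (b : S → ℝ) (u : U) : ℝ :=
  ∑ s, ∑ v, b s * P s v * R s u v

/-- Belief-state observation model
`Pr_P(v,o|b,u) = Σ_{s'} Z(s',u,o) Σ_s T(s,u,v,s') P(s,v) b(s)`. -/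
def obsPr [Fintype S] (T : S → U → V → S → ℝ) (Z : S → U → O → ℝ)
    (P : S → V → ℝ) (b : S → ℝ) (u : U) (v : V) (o : O) : ℝ :=
  ∑ s', Z s' u o * ∑ s, T s u v s' * P s v * b s

/-- Unnormalized belief update
`F_P(b,u,v,o)(s') = Z(s',u,o) Σ_s T(s,u,v,s') P(s,v) b(s)`. -/
def unnormUpd [Fintype S] (T : S → U → V → S → ℝ) (Z : S → U → O → ℝ)
    (P : S → V → ℝ) (b : S → ℝ) (u : U) (v : V) (o : O) (s' : S) : ℝ :=
  Z s' u o * ∑ s, T s u v s' * P s v * b s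

/-- Normalized belief update `B_P(b,u,v,o)`. -/
def beliefUpd [Fintype S] (T : S → U → V → S → ℝ) (Z : S → U → O → ℝ)
    (P : S → V → ℝ) (b : S → ℝ) (u : U) (v : V) (o : O) (s' : S) : ℝ :=
  unnormUpd T Z P b u v o s' / obsPr T Z P b u v o

/-- Value function of I-POMDP Lite: `V^P_0(b) = 0` and
`V^P_{n+1}(b) = max_u [ R_P(b,u) + φ Σ_{v,o} Pr_P(v,o|b,u) V^P_n(B_P(b,u,v,o)) ]`
(summands with `Pr_P(v,o|b,u) = 0` vanish since they are multiplied by `0`). -/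
def valFun [Fintype S] [Fintype U] [Fintype V] [Fintype O] [Nonempty U]
    (T : S → U → V → S → ℝ) (Z : S → U → O → ℝ) (R : S → U → V → ℝ)
    (P : S → V → ℝ) (φ : ℝ) : ℕ → (S → ℝ) → ℝ
  | 0, _ => 0
  | n + 1, b => ⨆ u : U, (expR R P b u +
      φ * ∑ v, ∑ o, obsPr T Z P b u v o * valFun T Z R P φ n (beliefUpd T Z P b u v o))

/-- Q-function of I-POMDP Lite: `qFun … n` is `Q^P_{n+1}`, i.e.
`Q^P_{n+1}(b,u) = R_P(b,u) + φ Σ_{v,o} Pr_P(v,o|b,u) V^P_n(B_P(b,u,v,o))`,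
so that `V^P_{n+1}(b) = max_u (qFun … n b u)`. -/
def qFun [Fintype S] [Fintype U] [Fintype V] [Fintype O] [Nonempty U]
    (T : S → U → V → S → ℝ) (Z : S → U → O → ℝ) (R : S → U → V → ℝ)
    (P : S → V → ℝ) (φ : ℝ) (n : ℕ) (b : S → ℝ) (u : U) : ℝ :=
  expR R P b u +
    φ * ∑ v, ∑ o, obsPr T Z P b u v o * valFun T Z R P φ n (beliefUpd T Z P b u v o)

/-- Prediction error `ε_p = max_{s,v} |Pr*(s,v) − Pr(s,v)|`. -/
def predErr [Fintype S] [Fintype V] [Nonempty S] [Nonempty V]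
    (Pstar Ppred : S → V → ℝ) : ℝ :=
  ⨆ s : S, ⨆ v : V, |Pstar s v - Ppred s v|

/-- Expected total reward of executing the (greedy) policy `π` under the true
strategy `Pstar`: `J_0(b) = 0` and
`J_{k+1}(b) = R_{P*}(b,π_{k+1}(b)) + φ Σ_{v,o} Pr_{P*}(v,o|b,π_{k+1}(b)) J_k(B_{P*}(b,π_{k+1}(b),v,o))`. -/
def execJ [Fintype S] [Fintype V] [Fintype O]
    (T : S → U → V → S → ℝ) (Z : S → U → O → ℝ) (R : S → U → V → ℝ)
    (Pstar : S → V → ℝ) (φ : ℝ) (π : ℕ → (S → ℝ) → U) : ℕ → (S → ℝ) → ℝ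
  | 0, _ => 0
  | k + 1, b =>
      expR R Pstar b (π (k + 1) b) +
        φ * ∑ v, ∑ o, obsPr T Z Pstar b (π (k + 1) b) v o *
          execJ T Z R Pstar φ π k (beliefUpd T Z Pstar b (π (k + 1) b) v o)

/-- The Bellman backup of a value function `f` at the belief `b`. -/
def bellman [Fintype S] [Fintype V] [Fintype O]
    (T : S → U → V → S → ℝ) (Z : S → U → O → ℝ) (R : S → U → V → ℝ)
    (P : S → V → ℝ) (φ : ℝ) (f : (S → ℝ) → ℝ) (b : S → ℝ) : ℝ :=
  ⨆ u : U, (expR R P b u +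
    φ * ∑ v, ∑ o, obsPr T Z P b u v o * f (beliefUpd T Z P b u v o))

lemma abs_ciSup_sub_ciSup_le {ι : Type*} [Finite ι] [Nonempty ι] {f g : ι → ℝ} {c : ℝ}
    (h : ∀ i, |f i - g i| ≤ c) : |(⨆ i, f i) - ⨆ i, g i| ≤ c := by
  have hf : (⨆ i, f i) ≤ (⨆ i, g i) + c := ciSup_le fun i => by
    linarith [(abs_le.1 (h i)).2, le_ciSup (Set.finite_range g).bddAbove i]
  have hg : (⨆ i, g i) ≤ (⨆ i, f i) + c := ciSup_le fun i => by
    linarith [(abs_le.1 (h i)).1, le_ciSup (Set.finite_range f).bddAbove i]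
  exact abs_le.2 ⟨by linarith, by linarith⟩

section

variable [Fintype S] [Fintype V]
  {T : S → U → V → S → ℝ} {Z : S → U → O → ℝ} {P : S → V → ℝ} {b : S → ℝ}

lemma unnormUpd_nonneg (hT0 : ∀ s u v s', 0 ≤ T s u v s') (hZ0 : ∀ s' u o, 0 ≤ Z s' u o)
    (hP : IsStrategy P) (hb : IsBelief b) (u : U) (v : V) (o : O) (s' : S) :
    0 ≤ unnormUpd T Z P b u v o s' :=
  mul_nonneg (hZ0 _ _ _) (sum_nonneg fun _ _ =>
    mul_nonneg (mul_nonneg (hT0 _ _ _ _) (hP.1 _ _)) (hb.1 _))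

lemma obsPr_nonneg (hT0 : ∀ s u v s', 0 ≤ T s u v s') (hZ0 : ∀ s' u o, 0 ≤ Z s' u o)
    (hP : IsStrategy P) (hb : IsBelief b) (u : U) (v : V) (o : O) :
    0 ≤ obsPr T Z P b u v o :=
  sum_nonneg fun s' _ => unnormUpd_nonneg hT0 hZ0 hP hb u v o s'

lemma sum_obsPr [Fintype O]
    (hT1 : ∀ s u v, ∑ s', T s u v s' = 1) (hZ1 : ∀ s' u, ∑ o, Z s' u o = 1)
    (hP : IsStrategy P) (hb : IsBelief b) (u : U) :
    ∑ v, ∑ o, obsPr T Z P b u v o = 1 := by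
  have hv (v : V) : ∑ o, obsPr T Z P b u v o = ∑ s, P s v * b s := by
    unfold obsPr
    rw [sum_comm]
    simp_rw [← sum_mul, hZ1, one_mul]
    rw [sum_comm]
    simp_rw [mul_assoc, ← sum_mul, hT1, one_mul]
  simp_rw [hv]
  rw [sum_comm]
  simp_rw [← sum_mul, hP.2, one_mul]
  exact hb.2

lemma isBelief_beliefUpd (hT0 : ∀ s u v s', 0 ≤ T s u v s') (hZ0 : ∀ s' u o, 0 ≤ Z s' u o)
    (hP : IsStrategy P) (hb : IsBelief b) {u : U} {v : V} {o : O}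
    (h : obsPr T Z P b u v o ≠ 0) : IsBelief (beliefUpd T Z P b u v o) := by
  refine ⟨fun s' => div_nonneg (unnormUpd_nonneg hT0 hZ0 hP hb u v o s')
    (obsPr_nonneg hT0 hZ0 hP hb u v o), ?_⟩
  unfold beliefUpd
  rw [← sum_div]
  exact div_self h

/-- The Bellman backup contracts the uniform distance on beliefs by the discount factor. -/
lemma abs_bellman_sub_bellman_le [Fintype O] [Finite U] [Nonempty U]
    (R : S → U → V → ℝ) {φ : ℝ}
    (hT0 : ∀ s u v s', 0 ≤ T s u v s') (hT1 : ∀ s u v, ∑ s', T s u v s' = 1)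
    (hZ0 : ∀ s' u o, 0 ≤ Z s' u o) (hZ1 : ∀ s' u, ∑ o, Z s' u o = 1)
    (hφ : 0 ≤ φ) (hP : IsStrategy P) {f g : (S → ℝ) → ℝ} {C : ℝ}
    (h : ∀ b, IsBelief b → |f b - g b| ≤ C) (hb : IsBelief b) :
    |bellman T Z R P φ f b - bellman T Z R P φ g b| ≤ φ * C := by
  refine abs_ciSup_sub_ciSup_le fun u => ?_
  rw [add_sub_add_left_eq_sub, ← mul_sub, abs_mul, abs_of_nonneg hφ]
  refine mul_le_mul_of_nonneg_left ?_ hφ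
  simp_rw [← sum_sub_distrib, ← mul_sub]
  calc _ ≤ ∑ v, ∑ o, obsPr T Z P b u v o * C := by
        refine (abs_sum_le_sum_abs _ _).trans (sum_le_sum fun v _ =>
          (abs_sum_le_sum_abs _ _).trans (sum_le_sum fun o _ => ?_))
        have h0 := obsPr_nonneg hT0 hZ0 hP hb u v o
        rw [abs_mul, abs_of_nonneg h0]
        by_cases hz : obsPr T Z P b u v o = 0
        · simp [hz]
        · exact mul_le_mul_of_nonneg_left
            (h _ (isBelief_beliefUpd hT0 hZ0 hP hb hz)) h0
    _ = C := by simp_rw [← sum_mul]; rw [sum_obsPr hT1 hZ1 hP hb u, one_mul]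

end

/-- **Theorem 2 (Convergence):** if `W` is a bounded function on beliefs satisfying
the Bellman fixed-point equation, then the value iteration of I-POMDP Lite contracts
towards it: `sup_b |W(b) − V_{n+1}(b)| ≤ φ · sup_b |W(b) − V_n(b)|`. -/
theorem ipomdp_lite_contraction
    [Fintype S] [Fintype U] [Fintype V] [Fintype O]
    [Nonempty S] [Nonempty U] [Nonempty V] [Nonempty O]
    (T : S → U → V → S → ℝ) (Z : S → U → O → ℝ) (R : S → U → V → ℝ)
    (Pr : S → V → ℝ) (φ : ℝ) (Rmax : ℝ)
    (hT0 : ∀ s u v s', 0 ≤ T s u v s') (hT1 : ∀ s u v, ∑ s', T s u v s' = 1)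
    (hZ0 : ∀ s' u o, 0 ≤ Z s' u o) (hZ1 : ∀ s' u, ∑ o, Z s' u o = 1)
    (hR : ∀ s u v, 0 ≤ R s u v ∧ R s u v ≤ Rmax)
    (hφ0 : 0 < φ) (hφ1 : φ < 1)
    (hPr : IsStrategy Pr)
    (W : (S → ℝ) → ℝ)
    (hWbdd : ∃ M : ℝ, ∀ b : S → ℝ, IsBelief b → |W b| ≤ M)
    (hWfix : ∀ b : S → ℝ, IsBelief b →
      W b = ⨆ u : U, (expR R Pr b u +
        φ * ∑ v, ∑ o, obsPr T Z Pr b u v o * W (beliefUpd T Z Pr b u v o)))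
    (n : ℕ) :
    (⨆ b : {b : S → ℝ // IsBelief b}, |W b.1 - valFun T Z R Pr φ (n + 1) b.1|) ≤
      φ * ⨆ b : {b : S → ℝ // IsBelief b}, |W b.1 - valFun T Z R Pr φ n b.1| := by
  have step (k : ℕ) (C : ℝ) (hC : ∀ b, IsBelief b → |W b - valFun T Z R Pr φ k b| ≤ C)
      (b : S → ℝ) (hb : IsBelief b) : |W b - valFun T Z R Pr φ (k + 1) b| ≤ φ * C := by
    rw [hWfix b hb]
    exact abs_bellman_sub_bellman_le R hT0 hT1 hZ0 hZ1 hφ0.le hPr hC hb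
  have bounded (k : ℕ) : ∃ C, ∀ b, IsBelief b → |W b - valFun T Z R Pr φ k b| ≤ C := by
    induction k with
    | zero => simpa [valFun] using hWbdd
    | succ k ih =>
      obtain ⟨C, hC⟩ := ih
      exact ⟨φ * C, step k C hC⟩
  obtain ⟨C, hC⟩ := bounded n
  have bdd : BddAbove (Set.range fun b : {b : S → ℝ // IsBelief b} =>
      |W b.1 - valFun T Z R Pr φ n b.1|) :=
    ⟨C, Set.forall_mem_range.2 fun b => hC b.1 b.2⟩
  exact Real.iSup_le
    (fun b => step n _ (fun b' hb' => le_ciSup bdd ⟨b', hb'⟩) b.1 b.2)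
    (mul_nonneg hφ0.le (Real.iSup_nonneg fun b => abs_nonneg _))
end
end

section
/- For every belief b, action u ∈ U, action v ∈ V and observation o ∈ O: Σ_{s'} |F_{Pr*}(b,u,v,o)(s') − F_{Pr}(b,u,v,o)(s')| ≤ ε_p, where for a strategy P the unnormalized belief update is F_P(b,u,v,o)(s') = Z(s',u,o) Σ_s T(s,u,v,s') P(s,v) b(s). -/
open Finset

noncomputable section

variable {S U V O : Type*}

theorem abs_sub_le_predErr [Fintype S] [Fintype V] [Nonempty S] [Nonempty V]
    (P Q : S → V → ℝ) (s : S) (v : V) : |P s v - Q s v| ≤ predErr P Q :=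
  (le_ciSup (f := fun v => |P s v - Q s v|) (Set.finite_range _).bddAbove v).trans
    (le_ciSup (f := fun s => ⨆ v, |P s v - Q s v|) (Set.finite_range _).bddAbove s)

theorem abs_unnormUpd_sub_le [Fintype S] [Fintype V] [Fintype O] [Nonempty S] [Nonempty V]
    {T : S → U → V → S → ℝ} {Z : S → U → O → ℝ} (P Q : S → V → ℝ)
    (hT0 : ∀ s u v s', 0 ≤ T s u v s')
    (hZ0 : ∀ s' u o, 0 ≤ Z s' u o) (hZ1 : ∀ s' u, ∑ o, Z s' u o = 1)
    {b : S → ℝ} (hb : ∀ s, 0 ≤ b s) (u : U) (v : V) (o : O) (s' : S) :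
    |unnormUpd T Z P b u v o s' - unnormUpd T Z Q b u v o s'| ≤
      ∑ s, T s u v s' * b s * predErr P Q := by
  have hZ : Z s' u o ≤ 1 :=
    (single_le_sum (fun o _ => hZ0 s' u o) (mem_univ o)).trans_eq (hZ1 s' u)
  have hsum : |∑ s, (T s u v s' * P s v * b s - T s u v s' * Q s v * b s)| ≤
      ∑ s, T s u v s' * b s * predErr P Q := by
    refine (abs_sum_le_sum_abs _ _).trans (sum_le_sum fun s _ => ?_)
    have hTb : 0 ≤ T s u v s' * b s := mul_nonneg (hT0 s u v s') (hb s)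
    rw [show T s u v s' * P s v * b s - T s u v s' * Q s v * b s =
      T s u v s' * b s * (P s v - Q s v) by ring, abs_mul, abs_of_nonneg hTb]
    exact mul_le_mul_of_nonneg_left (abs_sub_le_predErr P Q s v) hTb
  rw [unnormUpd, unnormUpd, ← mul_sub, ← sum_sub_distrib, abs_mul, abs_of_nonneg (hZ0 s' u o)]
  exact (mul_le_of_le_one_left (abs_nonneg _) hZ).trans hsum

/-- **Lemma 5:** the ℓ¹ distance between the unnormalized belief updates under the
true and predicted strategies is at most the prediction error:
`Σ_{s'} |F_{Pr*}(b,u,v,o)(s') − F_{Pr}(b,u,v,o)(s')| ≤ ε_p`. -/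
theorem ipomdp_lite_unnormalized_update_diff
    [Fintype S] [Fintype U] [Fintype V] [Fintype O]
    [Nonempty S] [Nonempty U] [Nonempty V] [Nonempty O]
    (T : S → U → V → S → ℝ) (Z : S → U → O → ℝ)
    (Pstar Ppred : S → V → ℝ)
    (hT0 : ∀ s u v s', 0 ≤ T s u v s') (hT1 : ∀ s u v, ∑ s', T s u v s' = 1)
    (hZ0 : ∀ s' u o, 0 ≤ Z s' u o) (hZ1 : ∀ s' u, ∑ o, Z s' u o = 1)
    (hPstar : IsStrategy Pstar) (hPpred : IsStrategy Ppred) :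
    ∀ b : S → ℝ, IsBelief b → ∀ (u : U) (v : V) (o : O),
      ∑ s', |unnormUpd T Z Pstar b u v o s' - unnormUpd T Z Ppred b u v o s'| ≤
        predErr Pstar Ppred := by
  intro b hb u v o
  calc ∑ s', |unnormUpd T Z Pstar b u v o s' - unnormUpd T Z Ppred b u v o s'|
      ≤ ∑ s', ∑ s, T s u v s' * b s * predErr Pstar Ppred :=
        sum_le_sum fun s' _ => abs_unnormUpd_sub_le Pstar Ppred hT0 hZ0 hZ1 hb.1 u v o s'
    _ = predErr Pstar Ppred := by
        rw [sum_comm]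
        simp only [← sum_mul, hT1, one_mul, hb.2]
end
end
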